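/- arXiv:2409.14198 — 4 statements merged into one kernel-verified Lean document; each statement's English description precedes it below -/
import Mathlib

section
/- Let (Y, μ) be a measure space, E a real normed vector space, ε > 0 and L₀ ≥ 0. Let ψ : Y → ℝ and C : E → Y → ℝ be such that for every y ∈ Y the map x ↦ C(x, y) is L₀-Lipschitz, and suppose that for every x ∈ E the integral ∫_Y exp((ψ(y) − C(x, y))/ε) dμ(y) is finite and strictly positive. Then the entropic dual potential φ(x) := −ε · log(∫_Y exp((ψ(y) − C(x, y))/ε) dμ(y)) is L₀-Lipschitz on E. -/
open MeasureTheory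

/-- Shifting the exponent by at most `c` raises the log-integral-exp by at most `c`. -/
theorem log_integral_exp_le_add {Y : Type*} [MeasurableSpace Y] {μ : Measure Y} {f g : Y → ℝ}
    {c : ℝ} (hf : Integrable (fun y => Real.exp (f y)) μ)
    (hg : Integrable (fun y => Real.exp (g y)) μ) (hf_pos : 0 < ∫ y, Real.exp (f y) ∂μ)
    (hfg : ∀ y, f y ≤ g y + c) :
    Real.log (∫ y, Real.exp (f y) ∂μ) ≤ Real.log (∫ y, Real.exp (g y) ∂μ) + c := by
  have hle : ∫ y, Real.exp (f y) ∂μ ≤ (∫ y, Real.exp (g y) ∂μ) * Real.exp c := by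
    rw [← integral_mul_const]
    refine integral_mono hf (hg.mul_const _) fun y => ?_
    simpa only [Real.exp_add] using Real.exp_le_exp.mpr (hfg y)
  have hg_pos : 0 < ∫ y, Real.exp (g y) ∂μ :=
    pos_of_mul_pos_left (hf_pos.trans_le hle) (Real.exp_pos c).le
  calc Real.log (∫ y, Real.exp (f y) ∂μ)
      ≤ Real.log ((∫ y, Real.exp (g y) ∂μ) * Real.exp c) := Real.log_le_log hf_pos hle
    _ = Real.log (∫ y, Real.exp (g y) ∂μ) + c := by
      rw [Real.log_mul hg_pos.ne' (Real.exp_pos c).ne', Real.log_exp]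

/-- Lemma 1: the entropic dual potential
`φ(x) = -ε · log ∫ exp((ψ(y) - C(x,y))/ε) dμ(y)` is `L₀`-Lipschitz whenever
the cost `C(·, y)` is `L₀`-Lipschitz for every `y`. -/
theorem entropic_dual_potential_lipschitz
    {Y : Type*} [MeasurableSpace Y] (μ : Measure Y)
    {E : Type*} [NormedAddCommGroup E] [NormedSpace ℝ E]
    (ε L₀ : ℝ) (hε : 0 < ε) (hL₀ : 0 ≤ L₀)
    (ψ : Y → ℝ) (C : E → Y → ℝ)
    (hC : ∀ y : Y, ∀ x₁ x₂ : E, |C x₁ y - C x₂ y| ≤ L₀ * ‖x₁ - x₂‖)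
    (hInt : ∀ x : E, Integrable (fun y => Real.exp ((ψ y - C x y) / ε)) μ)
    (hPos : ∀ x : E, 0 < ∫ y, Real.exp ((ψ y - C x y) / ε) ∂μ) :
    ∀ x₁ x₂ : E,
      |(-ε * Real.log (∫ y, Real.exp ((ψ y - C x₁ y) / ε) ∂μ)) -
        (-ε * Real.log (∫ y, Real.exp ((ψ y - C x₂ y) / ε) ∂μ))| ≤ L₀ * ‖x₁ - x₂‖ := by
  have key (a b : E) : ε * Real.log (∫ y, Real.exp ((ψ y - C a y) / ε) ∂μ) ≤
      ε * Real.log (∫ y, Real.exp ((ψ y - C b y) / ε) ∂μ) + L₀ * ‖a - b‖ := by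
    have hlog := log_integral_exp_le_add (c := L₀ * ‖a - b‖ / ε) (hInt a) (hInt b) (hPos a)
      fun y => by
        rw [← add_div]
        gcongr
        linarith [neg_le_of_abs_le (hC y a b)]
    have hmul := mul_le_mul_of_nonneg_left hlog hε.le
    rwa [mul_add, mul_div_cancel₀ _ hε.ne'] at hmul
  intro x₁ x₂
  have h₁₂ := key x₁ x₂
  have h₂₁ := key x₂ x₁
  rw [norm_sub_rev] at h₂₁
  rw [abs_le]
  constructor <;> linarith
end

section
/- Let E be a real normed vector space, ι a nonempty finite index set, ε > 0 and L₀ ≥ 0. Let ψ : ι → ℝ and C : ι → E → ℝ be such that for each i ∈ ι the function C i is differentiable on E with ‖D(C i)(x)‖ ≤ L₀ for every x ∈ E. Then the function φ(x) := −ε · log(∑_{i ∈ ι} exp((ψ(i) − C i (x))/ε)) is differentiable on E and its derivative satisfies ‖Dφ(x)‖ ≤ L₀ for every x ∈ E. -/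
/-- The derivative of a softmin is the average of the derivatives with Gibbs weights. -/
theorem hasFDerivAt_softmin
    {E : Type*} [NormedAddCommGroup E] [NormedSpace ℝ E]
    {ι : Type*} [Fintype ι] [Nonempty ι]
    {ε : ℝ} (hε : ε ≠ 0) (ψ : ι → ℝ) {C : ι → E → ℝ} {C' : ι → E →L[ℝ] ℝ} {x : E}
    (hC : ∀ i, HasFDerivAt (C i) (C' i) x) :
    HasFDerivAt (fun x : E => -ε * Real.log (∑ i, Real.exp ((ψ i - C i x) / ε)))
      (∑ i, (Real.exp ((ψ i - C i x) / ε) / ∑ j, Real.exp ((ψ j - C j x) / ε)) • C' i) x := by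
  have hS : (∑ j, Real.exp ((ψ j - C j x) / ε)) ≠ 0 :=
    (Finset.sum_pos (fun _ _ => Real.exp_pos _) Finset.univ_nonempty).ne'
  have hexp : ∀ i, HasFDerivAt (fun y => Real.exp ((ψ i - C i y) / ε))
      (Real.exp ((ψ i - C i x) / ε) • ε⁻¹ • -C' i) x := fun i => by
    simpa only [div_eq_mul_inv] using (((hC i).const_sub (ψ i)).mul_const ε⁻¹).exp
  refine (((HasFDerivAt.fun_sum fun i _ => hexp i).log hS).const_mul (-ε)).congr_fderiv ?_
  rw [Finset.smul_sum, Finset.smul_sum]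
  refine Finset.sum_congr rfl fun i _ => ?_
  ext v
  simp only [smul_apply, neg_apply, smul_eq_mul]
  field_simp

/-- Gradient-bound form of Lemma 1: the softmin
`φ(x) = -ε log Σ_i exp((ψ i - C i x)/ε)` is differentiable with `‖Dφ(x)‖ ≤ L₀`
whenever each `C i` is differentiable with derivative bounded in norm by `L₀`. -/
theorem softmin_grad_bound
    {E : Type*} [NormedAddCommGroup E] [NormedSpace ℝ E]
    {ι : Type*} [Fintype ι] [Nonempty ι]
    (ε L₀ : ℝ) (hε : 0 < ε) (hL₀ : 0 ≤ L₀)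
    (ψ : ι → ℝ) (C : ι → E → ℝ)
    (hdiff : ∀ i, Differentiable ℝ (C i))
    (hgrad : ∀ i, ∀ x : E, ‖fderiv ℝ (C i) x‖ ≤ L₀) :
    Differentiable ℝ (fun x : E => -ε * Real.log (∑ i, Real.exp ((ψ i - C i x) / ε))) ∧
      ∀ x : E,
        ‖fderiv ℝ (fun x : E => -ε * Real.log (∑ i, Real.exp ((ψ i - C i x) / ε))) x‖ ≤ L₀ := by
  have hφ := fun x => hasFDerivAt_softmin hε.ne' ψ fun i => (hdiff i x).hasFDerivAt
  refine ⟨fun x => (hφ x).differentiableAt, fun x => ?_⟩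
  rw [(hφ x).fderiv]
  have hS : 0 < ∑ j, Real.exp ((ψ j - C j x) / ε) :=
    Finset.sum_pos (fun _ _ => Real.exp_pos _) Finset.univ_nonempty
  rw [← mem_closedBall_zero_iff]
  refine (convex_closedBall _ _).sum_mem (fun i _ => by positivity) ?_
    fun i _ => mem_closedBall_zero_iff.2 (hgrad i x)
  rw [← Finset.sum_div, div_self hS.ne']
end

section
/- Let H be a real inner product space, β₁ > 0, and let l : H → ℝ be differentiable with β₁-Lipschitz gradient. Let θ, d ∈ H and nonnegative reals ε₁, ζ, η, δ, Γ, L, ε satisfy: ‖∇l(θ)‖ ≥ ε₁, ⟨∇l(θ), d⟩ ≥ ‖∇l(θ)‖² + ε₁·(ζ + η), and ‖d‖² ≤ ‖∇l(θ)‖² + L⁴·Γ²·ε² + L²·δ². Then l(θ − (1/β₁)·d) ≤ l(θ) − (ε₁² + 2ε₁(ζ + η) − L²(δ² + L²Γ²ε²))/(2β₁). -/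
open scoped RealInnerProductSpace

/-- The descent lemma: a differentiable function whose gradient is `K`-Lipschitz lies below
its quadratic upper model at every point. -/
theorem Differentiable.le_quadratic_of_gradient_lipschitz
    {H : Type*} [NormedAddCommGroup H] [InnerProductSpace ℝ H] [CompleteSpace H]
    {f : H → ℝ} (hf : Differentiable ℝ f) {K : ℝ}
    (hK : ∀ a b : H, ‖gradient f a - gradient f b‖ ≤ K * ‖a - b‖) (x v : H) :
    f (x + v) ≤ f x + ⟪gradient f x, v⟫ + K / 2 * ‖v‖ ^ 2 := by
  set φ : ℝ → ℝ := fun t ↦ f (x + t • v) - t * ⟪gradient f x, v⟫ - K / 2 * ‖v‖ ^ 2 * t ^ 2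
    with hφ
  have hφ' (t : ℝ) : HasDerivAt φ
      (⟪gradient f (x + t • v), v⟫ - ⟪gradient f x, v⟫ - K * ‖v‖ ^ 2 * t) t := by
    have hline : HasDerivAt (fun s : ℝ ↦ x + s • v) v t := by
      simpa using ((hasDerivAt_id t).smul_const v).const_add x
    have hcomp := (hf (x + t • v)).hasGradientAt.hasFDerivAt.comp_hasDerivAt t hline
    rw [InnerProductSpace.toDual_apply_apply] at hcomp
    refine ((hcomp.sub ((hasDerivAt_id t).mul_const ⟪gradient f x, v⟫)).sub
      ((hasDerivAt_pow 2 t).const_mul (K / 2 * ‖v‖ ^ 2))).congr_deriv ?_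
    push_cast
    ring
  have hanti : AntitoneOn φ (Set.Icc 0 1) := by
    refine antitoneOn_of_deriv_nonpos (convex_Icc 0 1)
      (fun t _ ↦ (hφ' t).continuousAt.continuousWithinAt)
      (fun t _ ↦ (hφ' t).differentiableAt.differentiableWithinAt) fun t ht ↦ ?_
    rw [interior_Icc] at ht
    rw [(hφ' t).deriv, ← inner_sub_left, sub_nonpos]
    calc ⟪gradient f (x + t • v) - gradient f x, v⟫
        ≤ ‖gradient f (x + t • v) - gradient f x‖ * ‖v‖ := real_inner_le_norm _ _
      _ ≤ K * ‖x + t • v - x‖ * ‖v‖ := by gcongr; exact hK _ _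
      _ = K * ‖v‖ ^ 2 * t := by
        rw [add_sub_cancel_left, norm_smul, Real.norm_of_nonneg ht.1.le]
        ring
  have h01 := hanti (Set.left_mem_Icc.2 zero_le_one) (Set.right_mem_Icc.2 zero_le_one) zero_le_one
  simp only [hφ, one_smul, zero_smul, add_zero] at h01
  linarith

/-- Per-iteration descent inequality (sup:eq24–sup:eq26) in the proof of
Proposition 2: one gradient step with step size `1/β₁` on the combined objective
decreases `l` by at least `(ε₁² + 2ε₁(ζ+η) - L²(δ² + L²Γ²ε²))/(2β₁)`. -/
theorem sinkhorn_descent_step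
    {H : Type*} [NormedAddCommGroup H] [InnerProductSpace ℝ H] [CompleteSpace H]
    (β₁ : ℝ) (hβ₁ : 0 < β₁)
    (l : H → ℝ) (hl : Differentiable ℝ l)
    (hlip : ∀ a b : H, ‖gradient l a - gradient l b‖ ≤ β₁ * ‖a - b‖)
    (θ d : H) (ε₁ ζ η δ Γ L ε : ℝ)
    (hε₁ : 0 ≤ ε₁) (hζ : 0 ≤ ζ) (hη : 0 ≤ η) (hδ : 0 ≤ δ)
    (hΓ : 0 ≤ Γ) (hL : 0 ≤ L) (hε : 0 ≤ ε)
    (hgradlb : ε₁ ≤ ‖gradient l θ‖)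
    (hinner : ‖gradient l θ‖ ^ 2 + ε₁ * (ζ + η) ≤ ⟪gradient l θ, d⟫)
    (hdub : ‖d‖ ^ 2 ≤ ‖gradient l θ‖ ^ 2 + L ^ 4 * Γ ^ 2 * ε ^ 2 + L ^ 2 * δ ^ 2) :
    l (θ - (1 / β₁) • d) ≤
      l θ - (ε₁ ^ 2 + 2 * ε₁ * (ζ + η) - L ^ 2 * (δ ^ 2 + L ^ 2 * Γ ^ 2 * ε ^ 2)) /
        (2 * β₁) := by
  have hdesc := hl.le_quadratic_of_gradient_lipschitz hlip θ (-((1 / β₁) • d))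
  rw [← sub_eq_add_neg, inner_neg_right, inner_smul_right, norm_neg, norm_smul,
    Real.norm_of_nonneg (by positivity)] at hdesc
  have hsq : ε₁ ^ 2 ≤ ‖gradient l θ‖ ^ 2 := by gcongr
  have hmodel : -(1 / β₁ * ⟪gradient l θ, d⟫) + β₁ / 2 * (1 / β₁ * ‖d‖) ^ 2 =
      -((2 * ⟪gradient l θ, d⟫ - ‖d‖ ^ 2) / (2 * β₁)) := by
    field_simp
    ring
  have hgain : (ε₁ ^ 2 + 2 * ε₁ * (ζ + η) - L ^ 2 * (δ ^ 2 + L ^ 2 * Γ ^ 2 * ε ^ 2)) / (2 * β₁) ≤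
      (2 * ⟪gradient l θ, d⟫ - ‖d‖ ^ 2) / (2 * β₁) := by
    refine div_le_div_of_nonneg_right ?_ (by positivity)
    linarith
  linarith
end

section
/- Let H be a real inner product space, β₁ > 0, l : H → ℝ differentiable with β₁-Lipschitz gradient and bounded below by l* ∈ ℝ. Let θ : ℕ → H and s, g : ℕ → H be sequences with θ(t+1) = θ(t) − (1/β₁)·(∇l(θ(t)) + s(t) − g(t)) for all t. Let ε₁, ζ, η, δ, Γ, L, ε be nonnegative reals with c := ε₁² + 2ε₁(ζ + η) − L²(δ² + L²Γ²ε²) > 0, and suppose that for all t < T: ‖∇l(θ(t))‖ ≥ ε₁, ⟨∇l(θ(t)), ∇l(θ(t)) + s(t) − g(t)⟩ ≥ ‖∇l(θ(t))‖² + ε₁(ζ + η), and ‖∇l(θ(t)) + s(t) − g(t)‖² ≤ ‖∇l(θ(t))‖² + L⁴Γ²ε² + L²δ². Then T ≤ 2β₁·(l(θ(0)) − l*)/c. -/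
open scoped RealInnerProductSpace

/-- **Descent lemma**: a differentiable function with `β`-Lipschitz gradient lies below its
quadratic upper model. -/
theorem le_add_inner_gradient_add_sq {H : Type*} [NormedAddCommGroup H] [InnerProductSpace ℝ H]
    [CompleteSpace H] {f : H → ℝ} {β : ℝ} (hf : Differentiable ℝ f)
    (hlip : ∀ a b : H, ‖gradient f a - gradient f b‖ ≤ β * ‖a - b‖) (x v : H) :
    f (x + v) ≤ f x + ⟪gradient f x, v⟫ + β / 2 * ‖v‖ ^ 2 := by
  let φ : ℝ → ℝ := fun t => f (x + t • v) - t * ⟪gradient f x, v⟫ - β / 2 * ‖v‖ ^ 2 * t ^ 2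
  have hφ : ∀ t, HasDerivAt φ
      (⟪gradient f (x + t • v), v⟫ - ⟪gradient f x, v⟫ - β * ‖v‖ ^ 2 * t) t := by
    intro t
    have hline : HasDerivAt (fun t : ℝ => x + t • v) v t := by
      simpa using ((hasDerivAt_id t).smul_const v).const_add x
    have hcomp := (hf (x + t • v)).hasFDerivAt.comp_hasDerivAt t hline
    rw [← inner_gradient_left] at hcomp
    refine ((hcomp.sub ((hasDerivAt_id t).mul_const ⟪gradient f x, v⟫)).sub
      ((hasDerivAt_pow 2 t).const_mul (β / 2 * ‖v‖ ^ 2))).congr_deriv ?_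
    norm_num
    ring
  have hanti : AntitoneOn φ (Set.Icc 0 1) := by
    refine antitoneOn_of_deriv_nonpos (convex_Icc 0 1)
      (fun t _ => (hφ t).continuousAt.continuousWithinAt)
      (fun t _ => (hφ t).differentiableAt.differentiableWithinAt) fun t ht => ?_
    rw [interior_Icc] at ht
    rw [(hφ t).deriv, ← inner_sub_left, sub_nonpos]
    calc ⟪gradient f (x + t • v) - gradient f x, v⟫
        ≤ ‖gradient f (x + t • v) - gradient f x‖ * ‖v‖ := real_inner_le_norm _ _
      _ ≤ β * ‖x + t • v - x‖ * ‖v‖ := by gcongr; exact hlip _ _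
      _ = β * ‖v‖ ^ 2 * t := by
        rw [add_sub_cancel_left, norm_smul, Real.norm_of_nonneg ht.1.le]
        ring
  have h := hanti (Set.left_mem_Icc.2 zero_le_one) (Set.right_mem_Icc.2 zero_le_one) zero_le_one
  simp only [φ, one_smul, zero_smul, add_zero] at h
  linarith

/-- If each of the first `T` steps decreases `u` by at least `c`, then `T * c` is at most the total
decrease. -/
theorem natCast_mul_le_sub_of_step {u : ℕ → ℝ} {c : ℝ} {T : ℕ}
    (h : ∀ t < T, u (t + 1) ≤ u t - c) : T * c ≤ u 0 - u T := by
  induction T with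
  | zero => simp
  | succ n ih =>
    have hn := ih fun t ht => h t (ht.trans n.lt_succ_self)
    have hstep := h n n.lt_succ_self
    push_cast
    linarith

/-- Proposition 2 (iteration complexity of SiRAN): under fixed-step gradient descent
`θ_{t+1} = θ_t - (1/β₁)(∇l(θ_t) + s_t - g_t)` with the stated gradient bounds,
the number of iterations `T` before reaching an `ε₁`-stationary point satisfies
`T ≤ 2β₁(l(θ₀) - l*)/(ε₁² + 2ε₁(ζ+η) - L²(δ² + L²Γ²ε²))`. -/
theorem sinkhorn_iteration_complexity
    {H : Type*} [NormedAddCommGroup H] [InnerProductSpace ℝ H] [CompleteSpace H]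
    (β₁ : ℝ) (hβ₁ : 0 < β₁)
    (l : H → ℝ) (hl : Differentiable ℝ l)
    (hlip : ∀ a b : H, ‖gradient l a - gradient l b‖ ≤ β₁ * ‖a - b‖)
    (lstar : ℝ) (hbound : ∀ x : H, lstar ≤ l x)
    (θ : ℕ → H) (s g : ℕ → H)
    (hupd : ∀ t : ℕ, θ (t + 1) = θ t - (1 / β₁) • (gradient l (θ t) + s t - g t))
    (ε₁ ζ η δ Γ L ε : ℝ)
    (hε₁ : 0 ≤ ε₁) (hζ : 0 ≤ ζ) (hη : 0 ≤ η) (hδ : 0 ≤ δ)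
    (hΓ : 0 ≤ Γ) (hL : 0 ≤ L) (hε : 0 ≤ ε)
    (hc : 0 < ε₁ ^ 2 + 2 * ε₁ * (ζ + η) - L ^ 2 * (δ ^ 2 + L ^ 2 * Γ ^ 2 * ε ^ 2))
    (T : ℕ)
    (hgradlb : ∀ t < T, ε₁ ≤ ‖gradient l (θ t)‖)
    (hinner : ∀ t < T,
      ‖gradient l (θ t)‖ ^ 2 + ε₁ * (ζ + η) ≤
        ⟪gradient l (θ t), gradient l (θ t) + s t - g t⟫)
    (hdub : ∀ t < T,
      ‖gradient l (θ t) + s t - g t‖ ^ 2 ≤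
        ‖gradient l (θ t)‖ ^ 2 + L ^ 4 * Γ ^ 2 * ε ^ 2 + L ^ 2 * δ ^ 2) :
    (T : ℝ) ≤ 2 * β₁ * (l (θ 0) - lstar) /
      (ε₁ ^ 2 + 2 * ε₁ * (ζ + η) - L ^ 2 * (δ ^ 2 + L ^ 2 * Γ ^ 2 * ε ^ 2)) := by
  set c := ε₁ ^ 2 + 2 * ε₁ * (ζ + η) - L ^ 2 * (δ ^ 2 + L ^ 2 * Γ ^ 2 * ε ^ 2) with hcdef
  have hstep : ∀ t < T, l (θ (t + 1)) ≤ l (θ t) - c / (2 * β₁) := by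
    intro t ht
    have hdesc := le_add_inner_gradient_add_sq hl hlip (θ t)
      (-((1 / β₁) • (gradient l (θ t) + s t - g t)))
    rw [← sub_eq_add_neg, ← hupd t, inner_neg_right, real_inner_smul_right, norm_neg, norm_smul,
      Real.norm_of_nonneg (by positivity)] at hdesc
    have hsq : ε₁ ^ 2 ≤ ‖gradient l (θ t)‖ ^ 2 := by
      gcongr
      exact hgradlb t ht
    have hin := hinner t ht
    have hd := hdub t ht
    set p := ⟪gradient l (θ t), gradient l (θ t) + s t - g t⟫
    set d := ‖gradient l (θ t) + s t - g t‖
    have hrw : -(1 / β₁ * p) + β₁ / 2 * (1 / β₁ * d) ^ 2 = -((2 * p - d ^ 2) / (2 * β₁)) := by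
      field_simp
      ring
    have hle : c / (2 * β₁) ≤ (2 * p - d ^ 2) / (2 * β₁) := by
      gcongr
      linarith
    linarith
  have hsum := natCast_mul_le_sub_of_step (u := fun t => l (θ t)) hstep
  have hb := hbound (θ T)
  rw [le_div_iff₀ hc]
  calc (T : ℝ) * c = 2 * β₁ * (T * (c / (2 * β₁))) := by field_simp
    _ ≤ 2 * β₁ * (l (θ 0) - lstar) := by
      gcongr
      linarith
end
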